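/- Let R be a local ring containing 1/2 (if R is not a field, assume its residue field has at least 5 elements). In the Witt K-theory ring KW_*(R), for all units a, b of R such that a + b is also a unit: (a) ⟨a⟩_KW + ⟨b⟩_KW = ⟨a+b⟩_KW + ⟨ab(a+b)⟩_KW in KW_0(R), and (b) [a] + [b] = [a+b] + [ab(a+b)] in KW_1(R). -/

import Mathlib

/-- The defining relations of the Witt `K`-theory ring of `R`: the generator `[a]`
(for `a ∈ Rˣ`) is encoded as `some a` (in degree `1`), and the generator `η` as
`none` (in degree `-1`). -/
inductive KWRel (R : Type) [CommRing R] :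
    FreeAlgebra ℤ (Option Rˣ) → FreeAlgebra ℤ (Option Rˣ) → Prop
  /-- (WK1) `η·[a] = [a]·η`. -/
  | comm (a : Rˣ) : KWRel R (FreeAlgebra.ι ℤ none * FreeAlgebra.ι ℤ (some a))
      (FreeAlgebra.ι ℤ (some a) * FreeAlgebra.ι ℤ none)
  /-- (WK2) `[ab] = [a] + [b] - η·[a]·[b]`. -/
  | mul (a b : Rˣ) : KWRel R (FreeAlgebra.ι ℤ (some (a * b)))
      (FreeAlgebra.ι ℤ (some a) + FreeAlgebra.ι ℤ (some b) -
        FreeAlgebra.ι ℤ none * FreeAlgebra.ι ℤ (some a) * FreeAlgebra.ι ℤ (some b))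
  /-- (WK3) `[a]·[1-a] = 0` for `a, 1-a ∈ Rˣ`. -/
  | steinberg (a b : Rˣ) (h : (a : R) + (b : R) = 1) :
      KWRel R (FreeAlgebra.ι ℤ (some a) * FreeAlgebra.ι ℤ (some b)) 0
  /-- (WK4) `2 = η·[-1]`. -/
  | hyperbolic : KWRel R 2 (FreeAlgebra.ι ℤ none * FreeAlgebra.ι ℤ (some (-1)))

/-- The Witt `K`-theory ring `KW_*(R)` of `R`: the quotient of the free `ℤ`-algebra on
generators `[a]` (`a ∈ Rˣ`, degree `1`) and `η` (degree `-1`) by the two-sided ideal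
generated by the relations (WK1)–(WK4). -/
def KW (R : Type) [CommRing R] := RingQuot (KWRel R)

noncomputable instance (R : Type) [CommRing R] : Ring (KW R) :=
  inferInstanceAs (Ring (RingQuot (KWRel R)))

namespace KW

variable (R : Type) [CommRing R]

/-- The degree-one generator `[a]` of `KW_*(R)`. -/
noncomputable def gen (a : Rˣ) : KW R :=
  RingQuot.mkRingHom (KWRel R) (FreeAlgebra.ι ℤ (some a))

/-- The degree-minus-one generator `η` of `KW_*(R)`. -/
noncomputable def eta : KW R :=
  RingQuot.mkRingHom (KWRel R) (FreeAlgebra.ι ℤ none)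

/-- `⟨a⟩ := 1 - η·[a]` in `KW_0(R)`. -/
noncomputable def gu (a : Rˣ) : KW R := 1 - eta R * gen R a

end KW

namespace KW

section Relations

variable {R : Type} [CommRing R]

theorem eta_mul_gen (a : Rˣ) : eta R * gen R a = gen R a * eta R := by
  have h := RingQuot.mkRingHom_rel (KWRel.comm a)
  simp only [map_mul] at h
  exact h

theorem gen_mul (a b : Rˣ) :
    gen R (a * b) = gen R a + gen R b - eta R * gen R a * gen R b := by
  have h := RingQuot.mkRingHom_rel (KWRel.mul a b)
  simp only [map_mul, map_add, map_sub] at h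
  exact h

theorem gen_mul_gen_of_add_eq_one {a b : Rˣ} (hab : (a : R) + (b : R) = 1) :
    gen R a * gen R b = 0 := by
  have h := RingQuot.mkRingHom_rel (KWRel.steinberg a b hab)
  simp only [map_mul, map_zero] at h
  exact h

theorem eta_mul_gen_neg_one : eta R * gen R (-1) = 2 := by
  have h := RingQuot.mkRingHom_rel (KWRel.hyperbolic (R := R))
  simp only [map_mul, map_ofNat] at h
  exact h.symm

theorem gen_mul_eq_add_gu_mul (a b : Rˣ) :
    gen R (a * b) = gen R a + gu R a * gen R b := by
  rw [gen_mul, gu, sub_mul, one_mul]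
  abel

theorem gu_mul_gen (a b : Rˣ) : gu R a * gen R b = gen R b * gu R a := by
  have h := gen_mul b a
  rw [mul_comm b a, gen_mul, eta_mul_gen b, mul_assoc (gen R b),
    add_comm (gen R b), sub_right_inj] at h
  rw [gu, sub_mul, mul_sub, one_mul, mul_one, h]

theorem gu_mul (a b : Rˣ) : gu R (a * b) = gu R a * gu R b := by
  have h : gu R (a * b) = gu R a - eta R * gu R a * gen R b := by
    rw [gu, gen_mul_eq_add_gu_mul, mul_add, ← mul_assoc]
    simp only [gu]
    abel
  have h' : eta R * gu R a = gu R a * eta R := by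
    simp only [gu, mul_sub, sub_mul, mul_one, one_mul]
    rw [mul_assoc (eta R) (gen R a), ← eta_mul_gen]
  rw [h, h', mul_assoc, show gu R b = 1 - eta R * gen R b from rfl, mul_sub, mul_one]

theorem gu_neg_one : gu R (-1) = -1 := by
  rw [gu, eta_mul_gen_neg_one]
  norm_num

theorem gu_one : gu R 1 = 1 := by
  have h := gu_mul (R := R) (-1) (-1)
  simpa [gu_neg_one] using h

theorem gen_one : gen R 1 = 0 := by
  have h := gen_mul_eq_add_gu_mul (R := R) 1 1
  simpa [gu_one] using h

theorem gu_neg (a : Rˣ) : gu R (-a) = -gu R a := by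
  rw [← neg_one_mul, gu_mul, gu_neg_one, neg_one_mul]

theorem gen_neg (a : Rˣ) : gen R (-a) = gen R (-1) - gen R a := by
  rw [← neg_one_mul, gen_mul_eq_add_gu_mul, gu_neg_one, neg_one_mul, sub_eq_add_neg]

theorem gu_mul_gen_inv (a : Rˣ) : gu R a * gen R a⁻¹ = -gen R a := by
  have h := gen_mul_eq_add_gu_mul a a⁻¹
  rw [mul_inv_cancel, gen_one] at h
  exact (neg_eq_of_add_eq_zero_right h.symm).symm

theorem gen_mul_gen_neg_of_isUnit {a : Rˣ} (ha : IsUnit (1 - (a : R))) :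
    gen R a * gen R (-a) = 0 := by
  obtain ⟨u, hu⟩ := ha
  have hu' : (a : R) + (u : R) = 1 := by rw [hu]; ring
  have hv : ((a⁻¹ : Rˣ) : R) + ((-a⁻¹ * u : Rˣ) : R) = 1 := by
    rw [Units.val_mul, hu, Units.val_neg]
    linear_combination Units.inv_mul a
  have e : gen R u = gen R (-a) + gu R (-a) * gen R (-a⁻¹ * u) := by
    rw [← gen_mul_eq_add_gu_mul]
    congr 1
    simp
  have h₁ : gen R a * gen R (-a⁻¹ * u) = 0 := by
    rw [← neg_neg (gen R a), ← gu_mul_gen_inv, neg_mul, mul_assoc,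
      gen_mul_gen_of_add_eq_one hv, mul_zero, neg_zero]
  have h₂ := gen_mul_gen_of_add_eq_one hu'
  rwa [e, mul_add, ← mul_assoc, ← gu_mul_gen, mul_assoc, h₁, mul_zero, add_zero] at h₂

theorem gen_mul_gen_neg_eq {a b : Rˣ} (hb : gen R b * gen R (-b) = 0)
    (hab : gen R (a * b) * gen R (-(a * b)) = 0) :
    gen R a * gen R (-a) = gu R a * (gen R a * gen R b - gen R b * gen R a) := by
  have e₁ : gen R (-(a * b)) = gen R (-a) - gu R a * gen R b := by
    rw [← neg_mul, gen_mul_eq_add_gu_mul, gu_neg, neg_mul, sub_eq_add_neg]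
  have e₂ : gen R (-(a * b)) = gen R a + gu R a * gen R (-b) := by
    rw [← mul_neg, gen_mul_eq_add_gu_mul]
  have e₃ : gen R a * (gu R a * gen R b) = gu R a * (gen R a * gen R b) := by
    rw [← mul_assoc, ← gu_mul_gen, mul_assoc]
  have e₄ : gen R b * (gu R a * gen R (-b)) = 0 := by
    rw [← mul_assoc, ← gu_mul_gen, mul_assoc, hb, mul_zero]
  rw [gen_mul_eq_add_gu_mul, add_mul, mul_assoc] at hab
  nth_rewrite 1 [e₁] at hab
  rw [e₂, mul_sub, mul_add, e₃, e₄, add_zero] at hab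
  rw [mul_sub, ← sub_eq_zero, ← hab]
  abel

theorem gen_mul_gen_neg_of_exists {a b : Rˣ} (hb : gen R b * gen R (-b) = 0)
    (hbb : gen R (b * b) * gen R (-(b * b)) = 0)
    (hab : gen R (a * b) * gen R (-(a * b)) = 0)
    (habb : gen R (a * (b * b)) * gen R (-(a * (b * b))) = 0) :
    gen R a * gen R (-a) = 0 := by
  have h₁ := gen_mul_gen_neg_eq hb hab
  have h₂ := gen_mul_gen_neg_eq hbb habb
  have e : gen R a * gen R (b * b) - gen R (b * b) * gen R a =
      (gen R a * gen R b - gen R b * gen R a) +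
        gu R b * (gen R a * gen R b - gen R b * gen R a) := by
    rw [gen_mul_eq_add_gu_mul, mul_add, add_mul, ← mul_assoc (gen R a), ← gu_mul_gen]
    noncomm_ring
  rw [e, mul_add, ← h₁, ← mul_assoc, ← gu_mul, mul_comm a b, gu_mul, mul_assoc, ← h₁,
    left_eq_add] at h₂
  rw [← one_mul (gen R a * _), ← gu_one, ← inv_mul_cancel b, gu_mul, mul_assoc, h₂, mul_zero]

theorem gen_sq_eq_zero {a : Rˣ} (ha : gen R a * gen R (-a) = 0) : gen R (a * a) = 0 := by
  rw [gen_neg, mul_sub, sub_eq_zero] at ha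
  rw [gen_mul, mul_assoc, ← ha, ← mul_assoc, eta_mul_gen, mul_assoc, eta_mul_gen_neg_one,
    mul_two, sub_self]

section IsLocalRing

open IsLocalRing

variable [IsLocalRing R]

theorem _root_.IsLocalRing.exists_unit_isUnit_one_sub_sq
    (hR : 5 ≤ Cardinal.mk (ResidueField R)) :
    ∃ b : Rˣ, IsUnit (1 - (b : R)) ∧ IsUnit (1 - (b : R) * b) := by
  classical
  obtain ⟨x, hx⟩ : ∃ x : ResidueField R, x ∉ ({0, 1, -1} : Finset (ResidueField R)) := by
    by_contra! h
    have hle : Cardinal.mk (ResidueField R) ≤ 3 := by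
      rw [← Cardinal.mk_univ, ← Set.eq_univ_of_forall (s := (({0, 1, -1} :
        Finset (ResidueField R)) : Set (ResidueField R))) h, Finset.coe_sort_coe,
        Cardinal.mk_coe_finset]
      exact_mod_cast Finset.card_le_three
    have h53 := hR.trans hle
    norm_num at h53
  simp only [Finset.mem_insert, Finset.mem_singleton, not_or] at hx
  obtain ⟨r, rfl⟩ := residue_surjective x
  obtain ⟨b, rfl⟩ := (residue_ne_zero_iff_isUnit r).1 hx.1
  have h₁ : (1 : ResidueField R) - residue R b ≠ 0 := sub_ne_zero.2 (Ne.symm hx.2.1)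
  refine ⟨b, (residue_ne_zero_iff_isUnit _).1 (by simpa using h₁),
    (residue_ne_zero_iff_isUnit _).1 ?_⟩
  have h₂ : (1 : ResidueField R) + residue R b ≠ 0 := fun h =>
    hx.2.2 (eq_neg_of_add_eq_zero_right h)
  have := mul_ne_zero h₁ h₂
  rw [map_sub, map_one, map_mul]
  convert this using 1
  ring

theorem gen_mul_gen_neg (hR : IsField R ∨ 5 ≤ Cardinal.mk (ResidueField R)) (a : Rˣ) :
    gen R a * gen R (-a) = 0 := by
  by_cases ha : IsUnit (1 - (a : R))
  · exact gen_mul_gen_neg_of_isUnit ha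
  have of_isUnit : ∀ c : Rˣ, IsUnit (1 - (c : R)) →
      gen R (a * c) * gen R (-(a * c)) = 0 := fun c hc => by
    refine gen_mul_gen_neg_of_isUnit ?_
    rw [Units.val_mul]
    by_contra h
    have := nonunits_add h (mul_mem_nonunits_right (a := -(c : R)) ha)
    exact this (by convert hc using 1; ring)
  rcases hR with hR | hR
  · have ha1 : a = 1 := by
      by_contra hne
      obtain ⟨b, hb⟩ := hR.mul_inv_cancel
        (sub_ne_zero.2 fun h : (1 : R) = a => hne (Units.ext (by simpa using h.symm)))
      exact ha (IsUnit.of_mul_eq_one b hb)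
    rw [ha1, gen_one, zero_mul]
  · obtain ⟨b, hb, hbb⟩ := exists_unit_isUnit_one_sub_sq hR
    have hbb' : IsUnit (1 - ((b * b : Rˣ) : R)) := by rwa [Units.val_mul]
    exact gen_mul_gen_neg_of_exists (gen_mul_gen_neg_of_isUnit hb)
      (gen_mul_gen_neg_of_isUnit hbb') (of_isUnit b hb) (of_isUnit _ hbb')

theorem gen_mul_mul_self (hR : IsField R ∨ 5 ≤ Cardinal.mk (ResidueField R)) (a b : Rˣ) :
    gen R (a * (b * b)) = gen R a := by
  rw [gen_mul_eq_add_gu_mul, gen_sq_eq_zero (gen_mul_gen_neg hR b), mul_zero, add_zero]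

theorem gen_add_gen (hR : IsField R ∨ 5 ≤ Cardinal.mk (ResidueField R))
    {a b c : Rˣ} (hc : (c : R) = (a : R) + (b : R)) :
    gen R a + gen R b = gen R c + gen R (a * b * c) := by
  have hdiv : ∀ x : Rˣ, gen R (x * c⁻¹) = gen R (x * c) := fun x => by
    rw [← gen_mul_mul_self hR (x * c⁻¹) c]
    congr 1
    group
  have hst : gen R (a * c) * gen R (b * c) = 0 := by
    rw [← hdiv, ← hdiv]
    refine gen_mul_gen_of_add_eq_one ?_
    rw [Units.val_mul, Units.val_mul, ← add_mul, ← hc, Units.mul_inv]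
  have hab : gen R (a * b) = gen R (a * c) + gen R (b * c) := by
    rw [← gen_mul_mul_self hR (a * b) c, mul_mul_mul_comm, gen_mul, mul_assoc, hst, mul_zero,
      sub_zero]
  have hgu : ∀ x : Rˣ, gu R c * gen R (x * c) = gen R x - gen R c := fun x => by
    have h := gen_mul_eq_add_gu_mul c (x * c)
    rw [mul_left_comm, gen_mul_mul_self hR] at h
    rw [h, add_sub_cancel_left]
  rw [mul_comm (a * b) c, gen_mul_eq_add_gu_mul, hab, mul_add, hgu, hgu]
  abel

end IsLocalRing

end Relations

end KW

open IsLocalRing in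
/-- **Statement 11.** Let `R` be a local ring containing `1/2` (if `R` is not a field its
residue field has at least 5 elements).  In `KW_*(R)`, for all units `a, b` of `R` such
that `a + b` is also a unit (say `a + b = c` with `c ∈ Rˣ`):
(a) `⟨a⟩ + ⟨b⟩ = ⟨a+b⟩ + ⟨ab(a+b)⟩` in `KW_0(R)`, and
(b) `[a] + [b] = [a+b] + [ab(a+b)]` in `KW_1(R)`. -/
theorem statement11 (R : Type) [CommRing R] [IsLocalRing R] [Invertible (2 : R)]
    (hR : IsField R ∨ 5 ≤ Cardinal.mk (ResidueField R))
    (a b c : Rˣ) (hc : (c : R) = (a : R) + (b : R)) :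
    KW.gu R a + KW.gu R b = KW.gu R c + KW.gu R (a * b * c) ∧
    KW.gen R a + KW.gen R b = KW.gen R c + KW.gen R (a * b * c) := by
  have h := KW.gen_add_gen hR hc
  refine ⟨?_, h⟩
  have h' := congrArg (KW.eta R * ·) h
  simp only [mul_add] at h'
  rw [KW.gu, KW.gu, KW.gu, KW.gu, sub_add_sub_comm, sub_add_sub_comm, h']
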